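/- Assume the matrix Ξ is positive-definite. Then the bilinear form b̃ satisfies a Garding inequality: there exist constants c > 0 and λ > 0 such that for all v ∈ C_c^∞(Ω), b̃(v,v) ≥ c |v|_𝒱² − λ ‖v‖²_{L²(Ω)}. -/

import Mathlib

open MeasureTheory

/-- Partial derivative in the `i`-th coordinate direction. -/
noncomputable def pd {d : ℕ} (f : (Fin d → ℝ) → ℝ) (i : Fin d) (x : Fin d → ℝ) : ℝ :=
  fderiv ℝ f x (Pi.single i 1)

/-- The open unit cube `Ω = (0,1)^d`. -/
def cube (d : ℕ) : Set (Fin d → ℝ) := Set.univ.pi fun _ => Set.Ioo (0 : ℝ) 1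

/-- The diffusion matrix `A_{ij}(x) = (ρ_{ij} σ_i σ_j / 2) x_i x_j (1-x_i)(1-x_j)`. -/
noncomputable def Amat {d : ℕ} (σ : Fin d → ℝ) (ρ : Fin d → Fin d → ℝ)
    (i j : Fin d) (x : Fin d → ℝ) : ℝ :=
  ρ i j * σ i * σ j / 2 * (x i * x j * (1 - x i) * (1 - x j))

/-- `ã_i(x) = r + σ_i² x_i - σ_i² + (σ_i/2) ∑_{j≠i} ρ_{ij} σ_j (2x_j - 1)`. -/
noncomputable def atilde {d : ℕ} (σ : Fin d → ℝ) (ρ : Fin d → Fin d → ℝ) (r : ℝ)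
    (i : Fin d) (x : Fin d → ℝ) : ℝ :=
  r + σ i ^ 2 * x i - σ i ^ 2 +
    σ i / 2 * ∑ j ∈ Finset.univ.erase i, ρ i j * σ j * (2 * x j - 1)

/-- The drift vector field `a_i(x) = x_i (1-x_i) ã_i(x)`. -/
noncomputable def avec {d : ℕ} (σ : Fin d → ℝ) (ρ : Fin d → Fin d → ℝ) (r : ℝ)
    (i : Fin d) (x : Fin d → ℝ) : ℝ :=
  x i * (1 - x i) * atilde σ ρ r i x

/-- The square of the seminorm `|v|_𝒱² = ∑_i ∫_Ω |x_i (1-x_i) ∂v/∂x_i|²`. -/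
noncomputable def Vsemisq {d : ℕ} (v : (Fin d → ℝ) → ℝ) : ℝ :=
  ∑ i, ∫ x in cube d, (x i * (1 - x i) * pd v i x) ^ 2

/-- The norm `‖v‖_𝒱 = (‖v‖²_{L²(Ω)} + |v|_𝒱²)^{1/2}`. -/
noncomputable def Vnorm {d : ℕ} (v : (Fin d → ℝ) → ℝ) : ℝ :=
  Real.sqrt ((∫ x in cube d, (v x) ^ 2) + Vsemisq v)

/-- The bilinear form `b̃(v,w) = ∫_Ω (A∇v)·∇w - ∫_Ω (a·∇v) w + r ∫_Ω v w`. -/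
noncomputable def btilde {d : ℕ} (σ : Fin d → ℝ) (ρ : Fin d → Fin d → ℝ) (r : ℝ)
    (v w : (Fin d → ℝ) → ℝ) : ℝ :=
  (∫ x in cube d, ∑ i, (∑ j, Amat σ ρ i j x * pd v j x) * pd w i x)
    - (∫ x in cube d, (∑ i, avec σ ρ r i x * pd v i x) * w x)
    + r * ∫ x in cube d, v x * w x

/-- `v ∈ C_c^∞(Ω)`: smooth, compactly supported, with support inside `Ω = (0,1)^d`. -/
def IsTestFun {d : ℕ} (v : (Fin d → ℝ) → ℝ) : Prop :=
  ContDiff ℝ (⊤ : ℕ∞) v ∧ HasCompactSupport v ∧ tsupport v ⊆ cube d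

theorem quad_lower {d : ℕ} (B : Matrix (Fin d) (Fin d) ℝ) (hB : B.PosDef) :
    ∃ k : ℝ, 0 < k ∧ ∀ y : Fin d → ℝ, k * ∑ i, y i ^ 2 ≤ ∑ i, (∑ j, B i j * y j) * y i := by
  have hQc : Continuous fun y : Fin d → ℝ => ∑ i, (∑ j, B i j * y j) * y i := by fun_prop
  have hpos : ∀ y : Fin d → ℝ, y ≠ 0 → 0 < ∑ i, (∑ j, B i j * y j) * y i := by
    intro y hy
    have h := hB.dotProduct_mulVec_pos hy
    simp only [dotProduct, Matrix.mulVec, star_trivial] at h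
    simpa [mul_comm] using h
  have hS : IsCompact (Metric.sphere (0 : Fin d → ℝ) 1) := isCompact_sphere _ _
  obtain ⟨m, hm, hmS⟩ : ∃ m : ℝ, 0 < m ∧ ∀ y ∈ Metric.sphere (0 : Fin d → ℝ) 1,
      m ≤ ∑ i, (∑ j, B i j * y j) * y i := by
    rcases (Metric.sphere (0 : Fin d → ℝ) 1).eq_empty_or_nonempty with h | h
    · exact ⟨1, one_pos, by simp [h]⟩
    · obtain ⟨z, hz, hmin⟩ := hS.exists_isMinOn h hQc.continuousOn
      refine ⟨_, hpos z ?_, fun y hy => hmin hy⟩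
      rintro rfl
      simp at hz
  have key : ∀ y : Fin d → ℝ, m * ‖y‖ ^ 2 ≤ ∑ i, (∑ j, B i j * y j) * y i := by
    intro y
    by_cases hy : y = 0
    · simp [hy]
    · have hn : 0 < ‖y‖ := norm_pos_iff.mpr hy
      have h := hmS (‖y‖⁻¹ • y) (by simp [norm_smul, hn.ne'])
      have e : ∑ i, (∑ j, B i j * (‖y‖⁻¹ • y) j) * (‖y‖⁻¹ • y) i
          = (‖y‖ ^ 2)⁻¹ * ∑ i, (∑ j, B i j * y j) * y i := by
        simp only [Pi.smul_apply, smul_eq_mul, Finset.mul_sum, Finset.sum_mul]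
        refine Finset.sum_congr rfl fun i _ => Finset.sum_congr rfl fun j _ => ?_
        ring
      rw [e, inv_mul_eq_div, le_div_iff₀ (by positivity)] at h
      exact h
  refine ⟨m / (d + 1), by positivity, fun y => le_trans ?_ (key y)⟩
  have h1 : ∑ i, y i ^ 2 ≤ (d + 1) * ‖y‖ ^ 2 := by
    have : ∑ i, y i ^ 2 ≤ ∑ _i : Fin d, ‖y‖ ^ 2 := by
      refine Finset.sum_le_sum fun i _ => ?_
      rw [← sq_abs]
      exact pow_le_pow_left₀ (abs_nonneg _) (norm_le_pi_norm y i) 2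
    simp at this
    nlinarith [sq_nonneg ‖y‖]
  calc m / (d + 1) * ∑ i, y i ^ 2 ≤ m / (d + 1) * ((d + 1) * ‖y‖ ^ 2) := by gcongr
    _ = m * ‖y‖ ^ 2 := by field_simp

theorem cont_intOn_cube {d : ℕ} {f : (Fin d → ℝ) → ℝ} (hf : Continuous f) :
    IntegrableOn f (cube d) := by
  refine (hf.continuousOn.integrableOn_compact
    (isCompact_univ_pi fun _ : Fin d => isCompact_Icc (a := (0 : ℝ)) (b := 1))).mono_set ?_
  exact Set.pi_mono fun _ _ => Set.Ioo_subset_Icc_self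

/-- Garding inequality for the bilinear form `b̃`: if the matrix `Ξ_{ij} = ρ_{ij} σ_i σ_j`
is positive-definite, there exist `c > 0` and `lam > 0` such that for all `v ∈ C_c^∞(Ω)`,
`b̃(v,v) ≥ c |v|_𝒱² - lam ‖v‖²_{L²(Ω)}`. -/
theorem btilde_garding
    {d : ℕ} (hd : 1 ≤ d) (σ : Fin d → ℝ) (hσ : ∀ i, 0 < σ i)
    (ρ : Fin d → Fin d → ℝ) (hρsymm : ∀ i j, ρ i j = ρ j i) (hρdiag : ∀ i, ρ i i = 1)
    (r : ℝ) (hr : 0 ≤ r)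
    (hΞ : (Matrix.of fun i j : Fin d => ρ i j * σ i * σ j).PosDef) :
    ∃ c lam : ℝ, 0 < c ∧ 0 < lam ∧ ∀ v : (Fin d → ℝ) → ℝ, IsTestFun v →
      btilde σ ρ r v v ≥ c * Vsemisq v - lam * ∫ x in cube d, (v x) ^ 2 := by
  obtain ⟨k, hk, hQ⟩ := quad_lower _ hΞ
  have hatc : ∀ i, Continuous (atilde σ ρ r i) := by
    intro i
    unfold atilde
    fun_prop
  obtain ⟨M, hM⟩ : ∃ M : ℝ, ∀ x ∈ cube d, ∑ i, atilde σ ρ r i x ^ 2 ≤ M := by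
    have hc : Continuous fun x => ∑ i, atilde σ ρ r i x ^ 2 := by fun_prop
    obtain ⟨M, hM⟩ := (isCompact_univ_pi fun _ : Fin d =>
      isCompact_Icc (a := (0 : ℝ)) (b := 1)).bddAbove_image hc.continuousOn
    refine ⟨M, fun x hx => hM ⟨x, ?_, rfl⟩⟩
    exact Set.pi_mono (fun _ _ => Set.Ioo_subset_Icc_self) hx
  refine ⟨k / 4, |M| / k + 1, by positivity, by positivity, fun v hv => ?_⟩
  have hvc : Continuous v := hv.1.continuous
  have hpc : ∀ i, Continuous (pd v i) := by
    intro i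
    unfold pd
    exact (hv.1.continuous_fderiv (by simp)).clm_apply continuous_const
  have hAc : ∀ i j, Continuous (Amat σ ρ i j) := by
    intro i j
    unfold Amat
    fun_prop
  have hac : ∀ i, Continuous (avec σ ρ r i) := by
    intro i
    unfold avec
    have := hatc i
    fun_prop
  have i1 := cont_intOn_cube (d := d)
    (f := fun x => ∑ i, (∑ j, Amat σ ρ i j x * pd v j x) * pd v i x) (by fun_prop)
  have i2 := cont_intOn_cube (d := d)
    (f := fun x => (∑ i, avec σ ρ r i x * pd v i x) * v x) (by fun_prop)
  have i3 := cont_intOn_cube (d := d) (f := fun x => v x ^ 2) (by fun_prop)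
  have i4 : ∀ i, IntegrableOn (fun x => (x i * (1 - x i) * pd v i x) ^ 2) (cube d) :=
    fun i => cont_intOn_cube (by fun_prop)
  have i5 : IntegrableOn (fun x => ∑ i, (x i * (1 - x i) * pd v i x) ^ 2) (cube d) :=
    cont_intOn_cube (by fun_prop)
  have hms : MeasurableSet (cube d) := MeasurableSet.univ_pi fun _ => measurableSet_Ioo
  have hV : Vsemisq v = ∫ x in cube d, ∑ i, (x i * (1 - x i) * pd v i x) ^ 2 := by
    unfold Vsemisq
    rw [integral_finset_sum _ fun i _ => i4 i]
  have hv2 : 0 ≤ r * ∫ x in cube d, v x * v x :=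
    mul_nonneg hr (integral_nonneg fun x => mul_self_nonneg _)
  have main : k / 4 * (∫ x in cube d, ∑ i, (x i * (1 - x i) * pd v i x) ^ 2)
      - (|M| / k + 1) * (∫ x in cube d, v x ^ 2)
      ≤ (∫ x in cube d, ∑ i, (∑ j, Amat σ ρ i j x * pd v j x) * pd v i x)
        - ∫ x in cube d, (∑ i, avec σ ρ r i x * pd v i x) * v x := by
    rw [← integral_const_mul, ← integral_const_mul,
      ← integral_sub (i5.const_mul _) (i3.const_mul _), ← integral_sub i1 i2]
    refine setIntegral_mono_on ((i5.const_mul _).sub (i3.const_mul _)) (i1.sub i2) hms ?_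
    intro x hx
    have hq := hQ fun i => x i * (1 - x i) * pd v i x
    have e1 : ∑ i, (∑ j, Amat σ ρ i j x * pd v j x) * pd v i x
        = 1 / 2 * ∑ i, (∑ j, (Matrix.of fun i j : Fin d => ρ i j * σ i * σ j) i j
          * (x j * (1 - x j) * pd v j x)) * (x i * (1 - x i) * pd v i x) := by
      simp only [Finset.mul_sum, Finset.sum_mul, Amat, Matrix.of_apply]
      refine Finset.sum_congr rfl fun i _ => Finset.sum_congr rfl fun j _ => ?_
      ring
    have e2 : (∑ i, avec σ ρ r i x * pd v i x) * v x
        ≤ k / 4 * ∑ i, (x i * (1 - x i) * pd v i x) ^ 2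
          + (∑ i, atilde σ ρ r i x ^ 2) * (v x ^ 2 / k) := by
      rw [Finset.sum_mul, Finset.mul_sum, Finset.sum_mul, ← Finset.sum_add_distrib]
      refine Finset.sum_le_sum fun i _ => ?_
      unfold avec
      generalize x i * (1 - x i) = p
      generalize atilde σ ρ r i x = t
      generalize pd v i x = q
      generalize v x = w
      have h : k / 4 * (p * q) ^ 2 + t ^ 2 * (w ^ 2 / k) - p * t * q * w
          = (k * (p * q) / 2 - t * w) ^ 2 / k := by
        field_simp
        ring
      have : 0 ≤ (k * (p * q) / 2 - t * w) ^ 2 / k := by positivity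
      linarith
    have e3 : (∑ i, atilde σ ρ r i x ^ 2) * (v x ^ 2 / k) ≤ |M| * (v x ^ 2 / k) :=
      mul_le_mul_of_nonneg_right ((hM x hx).trans (le_abs_self M)) (by positivity)
    have e4 : (|M| / k + 1) * v x ^ 2 = |M| * (v x ^ 2 / k) + v x ^ 2 := by ring
    have e5 := sq_nonneg (v x)
    show k / 4 * _ - (|M| / k + 1) * v x ^ 2 ≤ _ - _
    rw [e1, e4]
    linarith
  rw [hV]
  unfold btilde
  linarith
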